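/- arXiv:2605.25146 — 2 statements merged into one kernel-verified Lean document; each statement's English description precedes it below -/
import Mathlib

section
/- Let {Π_{ik}} be an α-unitary measurement design on ℂ^q with α > 0, let p_{ik} ∈ ℝ satisfy Σ_{k=1}^{q_i} p_{ik} = 1 for each i, and let Loss[S] := Σ_{i=1}^n Σ_{k=1}^{q_i} (tr(S Π_{ik}) − p_{ik})²/m_{ik}. Let ρ̂ be the unique minimizer of Loss over Hermitian matrices of trace 1. Then the unique minimizer of the Frobenius distance ‖ρ − ρ̂‖₂ over all density matrices ρ coincides with the unique minimizer of Loss[ρ] over all density matrices ρ; in particular the two argmin sets over density matrices are equal. -/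
open Matrix Finset
open scoped ComplexOrder

noncomputable section

/-- The Gram superoperator `G[S] = (1/n) Σ_i Σ_k (tr(S Π_{ik})/m_{ik}) Π_{ik}`. -/
def gramOf {q n : ℕ} (out : Fin n → ℕ)
    (P : (i : Fin n) → Fin (out i) → Matrix (Fin q) (Fin q) ℂ)
    (S : Matrix (Fin q) (Fin q) ℂ) : Matrix (Fin q) (Fin q) ℂ :=
  (n : ℂ)⁻¹ • ∑ i, ∑ k, ((S * P i k).trace / (P i k).trace) • P i k

/-- The least-squares loss `Loss[S] = Σ_{i,k} (tr(S Π_{ik}) − p_{ik})²/m_{ik}`. -/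
def lossOf {q n : ℕ} (out : Fin n → ℕ)
    (P : (i : Fin n) → Fin (out i) → Matrix (Fin q) (Fin q) ℂ)
    (p : (i : Fin n) → Fin (out i) → ℝ)
    (S : Matrix (Fin q) (Fin q) ℂ) : ℝ :=
  ∑ i, ∑ k, ((S * P i k).trace.re - p i k) ^ 2 / (P i k).trace.re

/-- The squared Frobenius (Hilbert–Schmidt) norm of a complex matrix. -/
def frobSq {q : ℕ} (M : Matrix (Fin q) (Fin q) ℂ) : ℝ :=
  ∑ a, ∑ b, Complex.normSq (M a b)

lemma Matrix.IsHermitian.ofReal_re_trace_mul {q : ℕ} {A B : Matrix (Fin q) (Fin q) ℂ}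
    (hA : A.IsHermitian) (hB : B.IsHermitian) :
    (((A * B).trace.re : ℝ) : ℂ) = (A * B).trace := by
  refine Complex.conj_eq_iff_re.mp ?_
  rw [starRingEnd_apply, ← trace_conjTranspose, conjTranspose_mul, hA.eq, hB.eq, trace_mul_comm]

lemma Matrix.IsHermitian.ofReal_re_trace {q : ℕ} {A : Matrix (Fin q) (Fin q) ℂ}
    (hA : A.IsHermitian) : ((A.trace.re : ℝ) : ℂ) = A.trace := by
  simpa using hA.ofReal_re_trace_mul isHermitian_one

lemma Matrix.IsHermitian.trace_mul_self {q : ℕ} {A : Matrix (Fin q) (Fin q) ℂ}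
    (hA : A.IsHermitian) : (A * A).trace = (frobSq A : ℂ) := by
  simp only [trace, diag_apply, mul_apply, frobSq, Complex.ofReal_sum]
  refine sum_congr rfl fun a _ => sum_congr rfl fun b _ => ?_
  rw [← hA.apply b a, ← Complex.mul_conj]
  rfl

/-- The parallelogram identity for the distances to a fixed matrix. -/
lemma frobSq_midpoint_sub {q : ℕ} (A B R : Matrix (Fin q) (Fin q) ℂ) :
    frobSq ((1 / 2 : ℝ) • (A + B) - R) =
      frobSq (A - R) / 2 + frobSq (B - R) / 2 - frobSq (A - B) / 4 := by
  simp only [frobSq, sum_div, ← sum_add_distrib, ← sum_sub_distrib]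
  refine sum_congr rfl fun a _ => sum_congr rfl fun b _ => ?_
  simp only [Complex.normSq_apply, Matrix.sub_apply, Matrix.smul_apply, Matrix.add_apply,
    Complex.sub_re, Complex.sub_im, Complex.smul_re, Complex.smul_im, Complex.add_re,
    Complex.add_im, smul_eq_mul]
  ring

section Frobenius

attribute [local instance] Matrix.frobeniusNormedAddCommGroup Matrix.frobeniusNormedSpace

lemma frobSq_eq_norm_sq {q : ℕ} (M : Matrix (Fin q) (Fin q) ℂ) : frobSq M = ‖M‖ ^ 2 := by
  rw [frobenius_norm_def, ← Real.sqrt_eq_rpow, Real.sq_sqrt (by positivity)]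
  simp [frobSq, Complex.normSq_eq_norm_sq]

lemma frobSq_nonneg {q : ℕ} (M : Matrix (Fin q) (Fin q) ℂ) : 0 ≤ frobSq M := by
  rw [frobSq_eq_norm_sq]
  positivity

lemma frobSq_eq_zero {q : ℕ} {M : Matrix (Fin q) (Fin q) ℂ} (h : frobSq M = 0) : M = 0 := by
  rwa [frobSq_eq_norm_sq, sq_eq_zero_iff, norm_eq_zero] at h

lemma isClosed_setOf_posSemidef_trace_eq_one (q : ℕ) :
    IsClosed {M : Matrix (Fin q) (Fin q) ℂ | M.PosSemidef ∧ M.trace = 1} := by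
  simp only [posSemidef_iff_dotProduct_mulVec, IsHermitian, Set.ofPred_and, Set.ofPred_forall]
  refine (IsClosed.inter ?_ (isClosed_iInter fun x => ?_)).inter ?_
  · exact isClosed_eq (by fun_prop) continuous_id
  · exact isClosed_le continuous_const (by fun_prop)
  · exact isClosed_eq (by fun_prop) continuous_const

lemma exists_posSemidef_trace_eq_one_frobSq_sub_le {q : ℕ} (hq : q ≠ 0)
    (R : Matrix (Fin q) (Fin q) ℂ) :
    ∃ ρ : Matrix (Fin q) (Fin q) ℂ, (ρ.PosSemidef ∧ ρ.trace = 1) ∧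
      ∀ ρ' : Matrix (Fin q) (Fin q) ℂ, ρ'.PosSemidef → ρ'.trace = 1 →
        frobSq (ρ - R) ≤ frobSq (ρ' - R) := by
  have hne : {M : Matrix (Fin q) (Fin q) ℂ | M.PosSemidef ∧ M.trace = 1}.Nonempty := by
    refine ⟨(q : ℝ)⁻¹ • 1, PosSemidef.one.smul (by positivity), ?_⟩
    simp [hq]
  have : ProperSpace (Matrix (Fin q) (Fin q) ℂ) := FiniteDimensional.proper ℂ _
  obtain ⟨ρ, hρ, hd⟩ := (isClosed_setOf_posSemidef_trace_eq_one q).exists_infDist_eq_dist hne R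
  refine ⟨ρ, hρ, fun ρ' h1 h2 => ?_⟩
  have h : dist R ρ ≤ dist R ρ' := hd ▸ Metric.infDist_le_dist_of_mem ⟨h1, h2⟩
  rw [dist_comm R, dist_comm R, dist_eq_norm, dist_eq_norm] at h
  rw [frobSq_eq_norm_sq, frobSq_eq_norm_sq]
  gcongr

end Frobenius

lemma existsUnique_posSemidef_trace_eq_one_frobSq_sub_le {q : ℕ} (hq : q ≠ 0)
    (R : Matrix (Fin q) (Fin q) ℂ) :
    ∃! ρ : Matrix (Fin q) (Fin q) ℂ, (ρ.PosSemidef ∧ ρ.trace = 1) ∧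
      ∀ ρ' : Matrix (Fin q) (Fin q) ℂ, ρ'.PosSemidef → ρ'.trace = 1 →
        frobSq (ρ - R) ≤ frobSq (ρ' - R) := by
  obtain ⟨ρ, hρ, hmin⟩ := exists_posSemidef_trace_eq_one_frobSq_sub_le hq R
  refine ⟨ρ, ⟨hρ, hmin⟩, ?_⟩
  rintro σ ⟨hσ, hσmin⟩
  have hmid := hmin ((1 / 2 : ℝ) • (σ + ρ)) ((hσ.1.add hρ.1).smul (by norm_num)) (by
    rw [trace_smul, trace_add, hσ.2, hρ.2, Complex.real_smul]
    norm_num)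
  rw [frobSq_midpoint_sub] at hmid
  have hle := hσmin ρ hρ.1 hρ.2
  exact sub_eq_zero.mp (frobSq_eq_zero (le_antisymm (by linarith) (frobSq_nonneg _)))

section Design

variable {q n : ℕ} {out : Fin n → ℕ} {P : (i : Fin n) → Fin (out i) → Matrix (Fin q) (Fin q) ℂ}

/-- The quadratic form of the loss is the quadratic form of the Gram superoperator. -/
lemma ofReal_sum_sq_div_eq_trace_mul_gramOf (hn : n ≠ 0) (hherm : ∀ i k, (P i k).IsHermitian)
    {Δ : Matrix (Fin q) (Fin q) ℂ} (hΔ : Δ.IsHermitian) :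
    ((∑ i, ∑ k, (Δ * P i k).trace.re ^ 2 / (P i k).trace.re : ℝ) : ℂ) =
      n * (Δ * gramOf out P Δ).trace := by
  have hn' : (n : ℂ) ≠ 0 := Nat.cast_ne_zero.mpr hn
  simp only [gramOf, mul_smul_comm, trace_smul, smul_eq_mul, mul_sum, trace_sum,
    Complex.ofReal_sum]
  refine sum_congr rfl fun i _ => sum_congr rfl fun k _ => ?_
  rw [Complex.ofReal_div, Complex.ofReal_pow, hΔ.ofReal_re_trace_mul (hherm i k),
    (hherm i k).ofReal_re_trace]
  field_simp

lemma sum_sq_div_eq_of_gramOf_eq_smul (hn : n ≠ 0) (hherm : ∀ i k, (P i k).IsHermitian)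
    {Δ : Matrix (Fin q) (Fin q) ℂ} (hΔ : Δ.IsHermitian) {α : ℝ}
    (hG : gramOf out P Δ = (α : ℂ) • Δ) :
    ∑ i, ∑ k, (Δ * P i k).trace.re ^ 2 / (P i k).trace.re = n * α * frobSq Δ := by
  have h := ofReal_sum_sq_div_eq_trace_mul_gramOf hn hherm hΔ
  rw [hG, mul_smul_comm, trace_smul, hΔ.trace_mul_self, smul_eq_mul, ← mul_assoc] at h
  exact_mod_cast h

lemma lossOf_add_smul (p : (i : Fin n) → Fin (out i) → ℝ) (R Δ : Matrix (Fin q) (Fin q) ℂ)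
    (t : ℝ) :
    lossOf out P p (R + t • Δ) =
      (∑ i, ∑ k, (Δ * P i k).trace.re ^ 2 / (P i k).trace.re) * (t * t) +
      (∑ i, ∑ k, 2 * ((R * P i k).trace.re - p i k) * (Δ * P i k).trace.re /
        (P i k).trace.re) * t + lossOf out P p R := by
  simp only [lossOf, sum_mul, ← sum_add_distrib]
  refine sum_congr rfl fun i _ => sum_congr rfl fun k _ => ?_
  rw [add_mul, smul_mul_assoc, trace_add, trace_smul, Complex.add_re, Complex.smul_re, smul_eq_mul]
  ring

/-- The loss splits orthogonally around its minimizer over trace-one Hermitian matrices. -/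
lemma lossOf_eq_add_frobSq_sub (hn : n ≠ 0) (hherm : ∀ i k, (P i k).IsHermitian) {α : ℝ}
    (hunitary : ∀ Δ : Matrix (Fin q) (Fin q) ℂ, Δ.IsHermitian → Δ.trace = 0 →
      gramOf out P Δ = (α : ℂ) • Δ)
    (p : (i : Fin n) → Fin (out i) → ℝ) {R S : Matrix (Fin q) (Fin q) ℂ}
    (hR : R.IsHermitian) (hRt : R.trace = 1)
    (hRmin : ∀ T : Matrix (Fin q) (Fin q) ℂ, T.IsHermitian → T.trace = 1 →
      lossOf out P p R ≤ lossOf out P p T)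
    (hS : S.IsHermitian) (hSt : S.trace = 1) :
    lossOf out P p S = lossOf out P p R + n * α * frobSq (S - R) := by
  have hΔ : (S - R).IsHermitian := hS.sub hR
  have hΔt : (S - R).trace = 0 := by rw [trace_sub, hSt, hRt, sub_self]
  have hdiscr := discrim_le_zero (K := ℝ) (c := 0) fun t => by
    have h := hRmin (R + t • (S - R)) (hR.add (hΔ.smul (IsSelfAdjoint.all t)))
      (by rw [trace_add, trace_smul, hΔt, smul_zero, add_zero, hRt])
    rw [lossOf_add_smul] at h
    simpa only [add_zero] using (le_add_iff_nonneg_left _).mp h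
  rw [discrim, mul_zero, sub_zero] at hdiscr
  have hlin := pow_eq_zero_iff two_ne_zero |>.mp (le_antisymm hdiscr (sq_nonneg _))
  have h := lossOf_add_smul (P := P) p R (S - R) 1
  rw [hlin, sum_sq_div_eq_of_gramOf_eq_smul hn hherm hΔ (hunitary _ hΔ hΔt), one_smul,
    add_sub_cancel] at h
  linarith

end Design

/-- For an `α`-unitary design (`α > 0`), the unique minimizer of the
Frobenius distance to the unconstrained least-squares estimator `ρ̂` over density matrices
coincides with the unique minimizer of the least-squares loss over density matrices: the two
argmin sets over density matrices are equal. -/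
theorem projection_equals_constrained_lse
    (q n : ℕ) (hq : 2 ≤ q) (hn : 1 ≤ n)
    (out : Fin n → ℕ) (hout : ∀ i, 2 ≤ out i)
    (P : (i : Fin n) → Fin (out i) → Matrix (Fin q) (Fin q) ℂ)
    (hherm : ∀ i k, (P i k).IsHermitian)
    (hproj : ∀ i k, P i k * P i k = P i k)
    (horth : ∀ i (k k' : Fin (out i)), k ≠ k' → P i k * P i k' = 0)
    (hsum : ∀ i, ∑ k, P i k = 1)
    (hP0 : ∀ i k, P i k ≠ 0)
    (α : ℝ) (hα : 0 < α)
    (hunitary : ∀ Δ : Matrix (Fin q) (Fin q) ℂ, Δ.IsHermitian → Δ.trace = 0 →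
        gramOf out P Δ = (α : ℂ) • Δ)
    (p : (i : Fin n) → Fin (out i) → ℝ) (hp : ∀ i, ∑ k, p i k = 1)
    (rhoHat : Matrix (Fin q) (Fin q) ℂ)
    (hrh : rhoHat.IsHermitian) (hrt : rhoHat.trace = 1)
    (hrmin : ∀ T : Matrix (Fin q) (Fin q) ℂ, T.IsHermitian → T.trace = 1 →
        lossOf out P p rhoHat ≤ lossOf out P p T) :
    (∃! ρ : Matrix (Fin q) (Fin q) ℂ, (ρ.PosSemidef ∧ ρ.trace = 1) ∧
        ∀ ρ' : Matrix (Fin q) (Fin q) ℂ, ρ'.PosSemidef → ρ'.trace = 1 →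
          frobSq (ρ - rhoHat) ≤ frobSq (ρ' - rhoHat))
    ∧
    (∀ ρ : Matrix (Fin q) (Fin q) ℂ, ρ.PosSemidef → ρ.trace = 1 →
      ((∀ ρ' : Matrix (Fin q) (Fin q) ℂ, ρ'.PosSemidef → ρ'.trace = 1 →
          frobSq (ρ - rhoHat) ≤ frobSq (ρ' - rhoHat))
        ↔
       (∀ ρ' : Matrix (Fin q) (Fin q) ℂ, ρ'.PosSemidef → ρ'.trace = 1 →
          lossOf out P p ρ ≤ lossOf out P p ρ'))) := by
  have hn0 : n ≠ 0 := Nat.one_le_iff_ne_zero.mp hn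
  refine ⟨existsUnique_posSemidef_trace_eq_one_frobSq_sub_le (by omega) rhoHat, fun ρ hρ hρt => ?_⟩
  refine forall₃_congr fun ρ' hρ' hρt' => ?_
  have hpos : 0 < (n : ℝ) * α := mul_pos (Nat.cast_pos.mpr hn) hα
  rw [lossOf_eq_add_frobSq_sub hn0 hherm hunitary p hrh hrt hrmin hρ.1 hρt,
    lossOf_eq_add_frobSq_sub hn0 hherm hunitary p hrh hrt hrmin hρ'.1 hρt',
    add_le_add_iff_left, mul_le_mul_iff_right₀ hpos]
end
end

section
/- Let q ≥ 2, let Π ∈ ℂ^{q×q} be a Hermitian projection of rank m ≥ 1, and let S ∈ ℂ^{q×q} be Hermitian with tr(S) = 0. Let U be a random unitary matrix distributed according to the Haar probability measure on U(q). Then (1/m) E[ tr(S U Π U*) · U Π U* ] = ((q − m)/(q − 1)) · S/(q(q+1)), where the expectation is the entrywise (Bochner) integral of the matrix-valued function over U(q). -/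
open Matrix Finset MeasureTheory

noncomputable section

instance matrixMeasurableSpace (q : ℕ) : MeasurableSpace (Matrix (Fin q) (Fin q) ℂ) :=
  inferInstanceAs (MeasurableSpace (Fin q → Fin q → ℂ))

section ConjugationInvariant

variable {q : ℕ} {ν : Measure (Matrix (Fin q) (Fin q) ℂ)}

instance matrixBorelSpace (q : ℕ) : BorelSpace (Matrix (Fin q) (Fin q) ℂ) :=
  (inferInstance : BorelSpace (Fin q → Fin q → ℂ))

theorem Matrix.continuous_conj (V : Matrix (Fin q) (Fin q) ℂ) :
    Continuous fun P : Matrix (Fin q) (Fin q) ℂ => V * P * Vᴴ := by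
  fun_prop

/-- Invariance of a measure on matrices under conjugation by unitary matrices. -/
def ConjInvariant (ν : Measure (Matrix (Fin q) (Fin q) ℂ)) : Prop :=
  ∀ V ∈ Matrix.unitaryGroup (Fin q) ℂ, ν.map (fun P => V * P * Vᴴ) = ν

/-- The mixed second moment of two entries of a random matrix. -/
def entryMoment (ν : Measure (Matrix (Fin q) (Fin q) ℂ)) (i j k l : Fin q) : ℂ :=
  ∫ P, P i j * P k l ∂ν

theorem entryMoment_comm (i j k l : Fin q) :
    entryMoment ν i j k l = entryMoment ν k l i j := by
  simp only [entryMoment, mul_comm]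

theorem ConjInvariant.integral_conj (hν : ConjInvariant ν)
    {V : Matrix (Fin q) (Fin q) ℂ} (hV : V ∈ Matrix.unitaryGroup (Fin q) ℂ)
    {f : Matrix (Fin q) (Fin q) ℂ → ℂ} (hf : Continuous f) :
    ∫ P, f (V * P * Vᴴ) ∂ν = ∫ P, f P ∂ν := by
  conv_rhs => rw [← hν V hV]
  exact (integral_map (V.continuous_conj).measurable.aemeasurable
    hf.aestronglyMeasurable).symm

theorem Matrix.diagonal_update_mem_unitaryGroup (p : Fin q) :
    diagonal (Function.update 1 p Complex.I) ∈ Matrix.unitaryGroup (Fin q) ℂ := by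
  rw [Matrix.mem_unitaryGroup_iff, star_eq_conjTranspose, diagonal_conjTranspose,
    diagonal_mul_diagonal, ← diagonal_one]
  congr 1
  ext i
  rcases eq_or_ne i p with rfl | h <;> simp [*]

/-- Invariance under diagonal unitaries kills all unbalanced moments. -/
theorem ConjInvariant.entryMoment_eq_zero (hν : ConjInvariant ν) {i j k l : Fin q} (p : Fin q)
    (h : (if i = p then Complex.I else 1) * (if j = p then -Complex.I else 1) *
      ((if k = p then Complex.I else 1) * (if l = p then -Complex.I else 1)) ≠ 1) :
    entryMoment ν i j k l = 0 := by
  have key := hν.integral_conj (diagonal_update_mem_unitaryGroup p)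
    (f := fun P => P i j * P k l) (by fun_prop)
  have e : ∀ P : Matrix (Fin q) (Fin q) ℂ,
      (diagonal (Function.update 1 p Complex.I) * P *
          (diagonal (Function.update 1 p Complex.I))ᴴ) i j *
        (diagonal (Function.update 1 p Complex.I) * P *
          (diagonal (Function.update 1 p Complex.I))ᴴ) k l =
      ((if i = p then Complex.I else 1) * (if j = p then -Complex.I else 1) *
        ((if k = p then Complex.I else 1) * (if l = p then -Complex.I else 1))) *
        (P i j * P k l) := by
    intro P
    simp only [diagonal_conjTranspose, mul_diagonal, diagonal_mul, Function.update_apply,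
      Pi.star_apply, Pi.one_apply, apply_ite star, star_one, RCLike.star_def, Complex.conj_I]
    ring
  simp only [e] at key
  rw [integral_const_mul] at key
  by_contra h0
  exact h (mul_right_cancel₀ h0 (key.trans (one_mul _).symm))

theorem Matrix.smul_one_add_smul_swap_mem_unitaryGroup {x y : ℂ} (a k : Fin q)
    (hxy : x * star x + y * star y = 1) (hxy' : x * star y + y * star x = 0) :
    x • (1 : Matrix (Fin q) (Fin q) ℂ) + y • Matrix.swap ℂ a k ∈
      Matrix.unitaryGroup (Fin q) ℂ := by
  have hs : (Matrix.swap ℂ a k)ᴴ = Matrix.swap ℂ a k := by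
    simp [Matrix.swap]
  have e : (x • (1 : Matrix (Fin q) (Fin q) ℂ) + y • Matrix.swap ℂ a k) *
      star (x • (1 : Matrix (Fin q) (Fin q) ℂ) + y • Matrix.swap ℂ a k) =
      (x * star x + y * star y) • (1 : Matrix (Fin q) (Fin q) ℂ) +
        (x * star y + y * star x) • Matrix.swap ℂ a k := by
    simp only [star_eq_conjTranspose, conjTranspose_add, conjTranspose_smul, conjTranspose_one,
      hs, add_mul, mul_add, smul_mul_smul_comm, one_mul, mul_one, Matrix.swap_mul_self, add_smul]
    abel
  rw [Matrix.mem_unitaryGroup_iff, e, hxy, hxy', one_smul, zero_smul, add_zero]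

theorem Matrix.smul_one_add_smul_swap_conj_apply (x y : ℂ) (a k : Fin q)
    (P : Matrix (Fin q) (Fin q) ℂ) (i j : Fin q) :
    ((x • (1 : Matrix (Fin q) (Fin q) ℂ) + y • Matrix.swap ℂ a k) * P *
      (x • (1 : Matrix (Fin q) (Fin q) ℂ) + y • Matrix.swap ℂ a k)ᴴ) i j =
      x * star x * P i j + x * star y * P i (Equiv.swap a k j) +
        (y * star x * P (Equiv.swap a k i) j +
          y * star y * P (Equiv.swap a k i) (Equiv.swap a k j)) := by
  have hs : (Matrix.swap ℂ a k)ᴴ = Matrix.swap ℂ a k := by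
    simp [Matrix.swap]
  rw [conjTranspose_add, conjTranspose_smul, conjTranspose_smul, conjTranspose_one, hs]
  simp only [add_mul, mul_add,
    smul_mul_assoc, mul_smul_comm, one_mul, mul_one, Matrix.add_apply, Matrix.smul_apply,
    smul_eq_mul, Matrix.swap, Equiv.Perm.permMatrix, PEquiv.toMatrix_toPEquiv_mul,
    PEquiv.mul_toMatrix_toPEquiv, Matrix.submatrix_apply, id, Equiv.symm_swap]
  ring

theorem ConjInvariant.integral_swap (hν : ConjInvariant ν) (a k : Fin q)
    {f : Matrix (Fin q) (Fin q) ℂ → ℂ} (hf : Continuous f) :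
    ∫ P, f (P.submatrix (Equiv.swap a k) (Equiv.swap a k)) ∂ν = ∫ P, f P ∂ν := by
  rw [← hν.integral_conj (smul_one_add_smul_swap_mem_unitaryGroup (x := 0) (y := 1) a k
    (by simp) (by simp)) hf]
  congr! with P
  ext i j
  rw [smul_one_add_smul_swap_conj_apply]
  simp

theorem Matrix.norm_apply_le_one_of_isHermitian_of_mul_self {P : Matrix (Fin q) (Fin q) ℂ}
    (hP : P.IsHermitian) (hPP : P * P = P) (i j : Fin q) : ‖P i j‖ ≤ 1 := by
  have hsum : P i i = ((∑ k, ‖P i k‖ ^ 2 : ℝ) : ℂ) := by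
    conv_lhs => rw [← hPP, Matrix.mul_apply]
    push_cast
    refine Finset.sum_congr rfl fun k _ => ?_
    rw [← hP.apply k i, ← Complex.mul_conj']
    rfl
  have hle : ∀ k, ‖P i k‖ ^ 2 ≤ ‖P i i‖ := fun k => by
    rw [hsum, Complex.norm_real]
    exact (Finset.single_le_sum (f := fun k => ‖P i k‖ ^ 2) (fun _ _ => by positivity)
      (Finset.mem_univ k)).trans (le_abs_self _)
  have h1 : ‖P i i‖ ≤ 1 := by nlinarith [hle i, norm_nonneg (P i i)]
  nlinarith [hle j, norm_nonneg (P i j)]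

theorem integrable_entry_mul_entry [IsFiniteMeasure ν]
    (hproj : ∀ᵐ P ∂ν, P.IsHermitian ∧ P * P = P) (i j k l : Fin q) :
    Integrable (fun P : Matrix (Fin q) (Fin q) ℂ => P i j * P k l) ν := by
  refine Integrable.of_bound (C := 1)
    (Continuous.aestronglyMeasurable (by fun_prop)) ?_
  filter_upwards [hproj] with P hP
  rw [norm_mul]
  exact mul_le_one₀ (norm_apply_le_one_of_isHermitian_of_mul_self hP.1 hP.2 _ _) (norm_nonneg _)
    (norm_apply_le_one_of_isHermitian_of_mul_self hP.1 hP.2 _ _)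

theorem integrable_entry [IsFiniteMeasure ν]
    (hproj : ∀ᵐ P ∂ν, P.IsHermitian ∧ P * P = P) (i j : Fin q) :
    Integrable (fun P : Matrix (Fin q) (Fin q) ℂ => P i j) ν := by
  refine Integrable.of_bound (C := 1)
    (Continuous.aestronglyMeasurable (by fun_prop)) ?_
  filter_upwards [hproj] with P hP
  exact norm_apply_le_one_of_isHermitian_of_mul_self hP.1 hP.2 _ _

theorem ConjInvariant.entryMoment_swap (hν : ConjInvariant ν) (a k : Fin q) (i j i' j' : Fin q) :
    entryMoment ν (Equiv.swap a k i) (Equiv.swap a k j) (Equiv.swap a k i') (Equiv.swap a k j') =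
      entryMoment ν i j i' j' :=
  hν.integral_swap a k (f := fun P => P i j * P i' j') (by fun_prop)

theorem ConjInvariant.entryMoment_diag (hν : ConjInvariant ν) [IsFiniteMeasure ν]
    (hproj : ∀ᵐ P ∂ν, P.IsHermitian ∧ P * P = P) {a k : Fin q} (hak : a ≠ k) :
    entryMoment ν a a a a = entryMoment ν a a k k + entryMoment ν a k k a := by
  have hI := integrable_entry_mul_entry hproj
  have hkk : entryMoment ν k k k k = entryMoment ν a a a a := by
    simpa using hν.entryMoment_swap a k a a a a
  have key := hν.integral_conj (smul_one_add_smul_swap_mem_unitaryGroup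
    (x := 3 / 5) (y := 4 / 5 * Complex.I) a k
    (by simp; ring_nf; simp; norm_num) (by simp; ring))
    (f := fun P => P a a * P a a) (by fun_prop)
  set c := (3 / 5 : ℂ) * star (3 / 5 : ℂ) with hc
  set d := (3 / 5 : ℂ) * star (4 / 5 * Complex.I) with hd
  set e := (4 / 5 * Complex.I) * star (3 / 5 : ℂ) with he
  set g := (4 / 5 * Complex.I) * star (4 / 5 * Complex.I) with hg
  have expand : ∀ P : Matrix (Fin q) (Fin q) ℂ,
      (c * P a a + d * P a k + (e * P k a + g * P k k)) *
        (c * P a a + d * P a k + (e * P k a + g * P k k)) =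
      ∑ s : Fin 4, ∑ t : Fin 4, ![c, d, e, g] s * ![c, d, e, g] t *
        (P (![a, a, k, k] s) (![a, k, a, k] s) * P (![a, a, k, k] t) (![a, k, a, k] t)) := by
    intro P
    simp [Fin.sum_univ_four]
    ring
  simp only [smul_one_add_smul_swap_conj_apply, Equiv.swap_apply_left, ← hc, ← hd, ← he, ← hg,
    expand] at key
  rw [integral_finsetSum _ fun s _ => integrable_finsetSum _ fun t _ => (hI ..).const_mul _] at key
  simp_rw [integral_finsetSum _ fun t _ => (hI ..).const_mul _, integral_const_mul] at key
  have hdef : ∀ i j k l, ∫ P, P i j * P k l ∂ν = entryMoment ν i j k l := fun _ _ _ _ => rfl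
  have hz : entryMoment ν a a a k = 0 ∧ entryMoment ν a a k a = 0 ∧ entryMoment ν a k a k = 0 ∧
      entryMoment ν k a k a = 0 ∧ entryMoment ν a k k k = 0 ∧ entryMoment ν k a k k = 0 := by
    refine ⟨?_, ?_, ?_, ?_, ?_, ?_⟩ <;>
      refine hν.entryMoment_eq_zero a ?_ <;> simp [hak.symm, Complex.ext_iff] <;> norm_num
  obtain ⟨z₁, z₂, z₃, z₄, z₅, z₆⟩ := hz
  simp only [hdef, Fin.sum_univ_four, Matrix.cons_val, entryMoment_comm k k a a,
    entryMoment_comm k a a k, entryMoment_comm a k a a, entryMoment_comm k a a a,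
    entryMoment_comm k k a k, entryMoment_comm k k k a, z₁, z₂, z₃, z₄, z₅, z₆, hkk] at key
  have hcv : c = 9 / 25 := by simp [hc]; norm_num
  have hgv : g = 16 / 25 := by simp [hg]; ring_nf; simp; norm_num
  have hdev : d * e = 144 / 625 := by simp [hd, he]; ring_nf; simp; norm_num
  rw [hcv, hgv] at key
  linear_combination (-625 / 288 : ℂ) * key +
    (625 / 144 : ℂ) * entryMoment ν a k k a * hdev

theorem ConjInvariant.integral_diag_entry (hν : ConjInvariant ν) [IsProbabilityMeasure ν]
    (hproj : ∀ᵐ P ∂ν, P.IsHermitian ∧ P * P = P) {t : ℂ} (htr : ∀ᵐ P ∂ν, P.trace = t)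
    (a : Fin q) : (q : ℂ) * ∫ P, P a a ∂ν = t := by
  have hdiag : ∀ k, ∫ P, P k k ∂ν = ∫ P, P a a ∂ν := fun k => by
    simpa using hν.integral_swap a k (f := fun P => P a a) (by fun_prop)
  have hsum : ∫ P : Matrix (Fin q) (Fin q) ℂ, P.trace ∂ν = t := by
    rw [integral_congr_ae htr]
    simp
  simp only [Matrix.trace, Matrix.diag_apply] at hsum
  rw [integral_finsetSum _ fun k _ => integrable_entry hproj k k] at hsum
  simpa [hdiag] using hsum

theorem Fin.sum_eq_add_mul_of_forall_ne {f : Fin q → ℂ} {c : ℂ} (a : Fin q)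
    (hf : ∀ k, k ≠ a → f k = c) : ∑ k, f k = f a + ((q : ℂ) - 1) * c := by
  have h : ∀ k, f k = c + if k = a then f a - c else 0 := fun k => by
    split_ifs with hk
    · rw [hk]; ring
    · rw [hf k hk, add_zero]
  rw [Finset.sum_congr rfl fun k _ => h k, Finset.sum_add_distrib, Finset.sum_ite_eq']
  simp
  ring

theorem ConjInvariant.entryMoment_diag_sum (hν : ConjInvariant ν) [IsProbabilityMeasure ν]
    (hproj : ∀ᵐ P ∂ν, P.IsHermitian ∧ P * P = P) {t : ℂ} (htr : ∀ᵐ P ∂ν, P.trace = t)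
    (a : Fin q) : (q : ℂ) * ∑ k, entryMoment ν a a k k = t * t := by
  simp only [entryMoment]
  rw [← integral_finsetSum _ fun k _ => integrable_entry_mul_entry hproj a a k k]
  have h : ∫ P, ∑ k, P a a * P k k ∂ν = ∫ P : Matrix (Fin q) (Fin q) ℂ, P a a * t ∂ν := by
    refine integral_congr_ae ?_
    filter_upwards [htr] with P hP
    rw [← Finset.mul_sum, ← hP]
    rfl
  rw [h, integral_mul_const, ← mul_assoc, hν.integral_diag_entry hproj htr]

theorem ConjInvariant.entryMoment_cross_sum (hν : ConjInvariant ν) [IsProbabilityMeasure ν]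
    (hproj : ∀ᵐ P ∂ν, P.IsHermitian ∧ P * P = P) {t : ℂ} (htr : ∀ᵐ P ∂ν, P.trace = t)
    (a : Fin q) : (q : ℂ) * ∑ k, entryMoment ν a k k a = t := by
  simp only [entryMoment]
  rw [← integral_finsetSum _ fun k _ => integrable_entry_mul_entry hproj a k k a]
  have h : ∫ P, ∑ k, P a k * P k a ∂ν = ∫ P : Matrix (Fin q) (Fin q) ℂ, P a a ∂ν := by
    refine integral_congr_ae ?_
    filter_upwards [hproj] with P hP
    rw [← Matrix.mul_apply, hP.2]
  rw [h, hν.integral_diag_entry hproj htr]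

theorem ConjInvariant.entryMoment_eq (hν : ConjInvariant ν) [IsProbabilityMeasure ν]
    (hproj : ∀ᵐ P ∂ν, P.IsHermitian ∧ P * P = P) {t : ℂ} (htr : ∀ᵐ P ∂ν, P.trace = t)
    {a k : Fin q} (hak : a ≠ k) :
    (q : ℂ) * (q + 1) * (q - 1) * entryMoment ν a k k a = t * (q - t) := by
  have h₁ : ∀ l, l ≠ a → entryMoment ν a a l l = entryMoment ν a a k k := fun l hl => by
    simpa [Equiv.swap_apply_of_ne_of_ne hak hl.symm] using hν.entryMoment_swap k l a a k k
  have h₂ : ∀ l, l ≠ a → entryMoment ν a l l a = entryMoment ν a k k a := fun l hl => by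
    simpa [Equiv.swap_apply_of_ne_of_ne hak hl.symm] using hν.entryMoment_swap k l a k k a
  have e₁ := hν.entryMoment_diag_sum hproj htr a
  have e₂ := hν.entryMoment_cross_sum hproj htr a
  rw [Fin.sum_eq_add_mul_of_forall_ne a h₁] at e₁
  rw [Fin.sum_eq_add_mul_of_forall_ne a h₂] at e₂
  have e₃ := hν.entryMoment_diag hproj hak
  linear_combination -e₁ + (q : ℂ) * e₂ - (q : ℂ) * ((q : ℂ) - 1) * e₃

/-- The moment `𝔼[tr(S P) P]` of a conjugation-invariant random projection `P` of trace `t`. -/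
theorem ConjInvariant.integral_trace_mul_entry (hν : ConjInvariant ν) [IsProbabilityMeasure ν]
    (hq : 2 ≤ q) (hproj : ∀ᵐ P ∂ν, P.IsHermitian ∧ P * P = P) {t : ℂ}
    (htr : ∀ᵐ P ∂ν, P.trace = t) {S : Matrix (Fin q) (Fin q) ℂ} (hS : S.trace = 0)
    (a b : Fin q) :
    (q : ℂ) * (q + 1) * (q - 1) * ∫ P, (S * P).trace * P a b ∂ν = t * (q - t) * S a b := by
  have hI : ∀ i j, Integrable (fun P : Matrix (Fin q) (Fin q) ℂ => S i j * (P j i * P a b)) ν :=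
    fun i j => (integrable_entry_mul_entry hproj j i a b).const_mul _
  have expand : ∫ P, (S * P).trace * P a b ∂ν = ∑ i, ∑ j, S i j * entryMoment ν j i a b := by
    simp only [Matrix.trace, Matrix.diag_apply, Matrix.mul_apply, Finset.sum_mul, mul_assoc]
    refine (integral_finsetSum _ fun i _ => integrable_finsetSum _ fun j _ => hI i j).trans
      (Finset.sum_congr rfl fun i _ => ?_)
    exact (integral_finsetSum _ fun j _ => hI i j).trans
      (Finset.sum_congr rfl fun j _ => integral_const_mul _ _)
  rw [expand]
  rcases eq_or_ne a b with rfl | hab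
  · have hoff : ∀ i j, j ≠ i → S i j * entryMoment ν j i a a = 0 := fun i j hji => by
      rw [hν.entryMoment_eq_zero j, mul_zero]
      by_cases haj : a = j <;> simp [haj, hji.symm, Complex.ext_iff]
    simp_rw [fun i => Finset.sum_eq_single_of_mem i (Finset.mem_univ i) fun j _ => hoff i j]
    have : Nontrivial (Fin q) := Fin.nontrivial_iff_two_le.2 hq
    obtain ⟨k, hka⟩ := exists_ne a
    have h₁ : ∀ l, l ≠ a → entryMoment ν l l a a = entryMoment ν a a k k := fun l hl => by
      rw [entryMoment_comm]
      simpa [Equiv.swap_apply_of_ne_of_ne hka.symm hl.symm] using hν.entryMoment_swap k l a a k k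
    have hsum : ∑ i, S i i * entryMoment ν i i a a =
        ∑ i, (S i i * entryMoment ν a a k k +
          if i = a then S i i * entryMoment ν a k k a else 0) := by
      refine Finset.sum_congr rfl fun i _ => ?_
      split_ifs with hi
      · rw [hi, hν.entryMoment_diag hproj hka.symm]; ring
      · rw [h₁ i hi, add_zero]
    rw [hsum, Finset.sum_add_distrib, ← Finset.sum_mul, Finset.sum_ite_eq',
      if_pos (Finset.mem_univ a), show ∑ i, S i i = 0 from hS]
    linear_combination S a a * hν.entryMoment_eq hproj htr hka.symm
  · rw [Finset.sum_eq_single_of_mem a (Finset.mem_univ a), Finset.sum_eq_single_of_mem b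
      (Finset.mem_univ b), entryMoment_comm]
    · linear_combination S a b * hν.entryMoment_eq hproj htr hab
    · intro j _ hj
      rw [hν.entryMoment_eq_zero b, mul_zero]
      simp [hj, hab, Complex.ext_iff]
    · intro i _ hi
      refine Finset.sum_eq_zero fun j _ => ?_
      rw [hν.entryMoment_eq_zero a, mul_zero]
      by_cases hj : j = a <;> simp [hj, hi, hab.symm, Complex.ext_iff]
      norm_num

end ConjugationInvariant

theorem Matrix.trace_eq_rank_of_mul_self {n K : Type*} [Fintype n] [DecidableEq n] [Field K]
    {E : Matrix n n K} (hE : E * E = E) : E.trace = E.rank := by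
  have h : IsIdempotentElem (Matrix.toLin' E) := by
    rw [IsIdempotentElem, Module.End.mul_eq_comp, ← Matrix.toLin'_mul, hE]
  rw [← Matrix.trace_toLin'_eq, (LinearMap.IsIdempotentElem.isProj_range _ h).trace,
    Matrix.rank_eq_finrank_range_toLin E (Pi.basisFun K n) (Pi.basisFun K n),
    Matrix.toLin_eq_toLin']

/-- **Haar moments for projections.** Let `E` be a Hermitian projection of
rank `m ≥ 1` in `ℂ^{q×q}`, `S` a traceless Hermitian matrix, and `U` Haar-distributed on the
unitary group `U(q)` (formalized as: any Borel probability measure concentrated on the unitary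
group and invariant under left translation by every unitary). Then, entrywise,
`(1/m) E[tr(S UEU*) · UEU*] = ((q−m)/(q−1)) · S/(q(q+1))`. -/
theorem haar_moment_projection
    (q m : ℕ) (hq : 2 ≤ q) (hm : 1 ≤ m)
    (E : Matrix (Fin q) (Fin q) ℂ)
    (hEherm : E.IsHermitian) (hEproj : E * E = E) (hErank : E.rank = m)
    (S : Matrix (Fin q) (Fin q) ℂ) (hS : S.IsHermitian) (hStr : S.trace = 0)
    (μ : Measure (Matrix (Fin q) (Fin q) ℂ))
    (hprob : IsProbabilityMeasure μ)
    (hsupp : μ {U : Matrix (Fin q) (Fin q) ℂ | U ∈ Matrix.unitaryGroup (Fin q) ℂ} = 1)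
    (hinv : ∀ V ∈ Matrix.unitaryGroup (Fin q) ℂ,
        Measure.map (fun U => V * U) μ = μ) :
    ∀ a b : Fin q,
      (m : ℂ)⁻¹ *
        (∫ U : Matrix (Fin q) (Fin q) ℂ,
            (S * (U * E * Uᴴ)).trace * (U * E * Uᴴ) a b ∂μ)
      = (((q : ℂ) - (m : ℂ)) / ((q : ℂ) - 1)) * (S a b / ((q : ℂ) * ((q : ℂ) + 1))) := by
  set c : Matrix (Fin q) (Fin q) ℂ → Matrix (Fin q) (Fin q) ℂ := fun U => U * E * Uᴴ with hc
  have hcont : Continuous c := by fun_prop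
  set ν := μ.map c with hν
  have : IsProbabilityMeasure ν := Measure.isProbabilityMeasure_map hcont.measurable.aemeasurable
  have hunit : ∀ᵐ U ∂μ, U ∈ Matrix.unitaryGroup (Fin q) ℂ := by
    have hclosed : IsClosed {U : Matrix (Fin q) (Fin q) ℂ | U ∈ Matrix.unitaryGroup (Fin q) ℂ} := by
      simp only [Matrix.mem_unitaryGroup_iff, star_eq_conjTranspose]
      exact isClosed_eq (by fun_prop) continuous_const
    exact (mem_ae_iff_prob_eq_one hclosed.measurableSet).2 hsupp
  have hconj : ConjInvariant ν := fun V hV => by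
    conv_rhs => rw [hν, ← hinv V hV]
    rw [hν, Measure.map_map V.continuous_conj.measurable hcont.measurable,
      Measure.map_map hcont.measurable (by fun_prop : Continuous fun U => V * U).measurable]
    congr 1
    ext1 U
    simp only [hc, Function.comp_apply, conjTranspose_mul, Matrix.mul_assoc]
  have hproj : ∀ᵐ P ∂ν, P.IsHermitian ∧ P * P = P := by
    have hclosed : IsClosed {P : Matrix (Fin q) (Fin q) ℂ | P.IsHermitian ∧ P * P = P} :=
      (isClosed_eq (by fun_prop) continuous_id).inter (isClosed_eq (by fun_prop) continuous_id)
    rw [hν, ae_map_iff hcont.measurable.aemeasurable hclosed.measurableSet]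
    filter_upwards [hunit] with U hU
    rw [Matrix.mem_unitaryGroup_iff', star_eq_conjTranspose] at hU
    refine ⟨isHermitian_mul_mul_conjTranspose U hEherm, ?_⟩
    calc U * E * Uᴴ * (U * E * Uᴴ) = U * E * (Uᴴ * U) * E * Uᴴ := by
          simp only [Matrix.mul_assoc]
      _ = U * E * Uᴴ := by rw [hU, Matrix.mul_one, Matrix.mul_assoc U, hEproj]
  have htr : ∀ᵐ P ∂ν, P.trace = (m : ℂ) := by
    have hclosed : IsClosed {P : Matrix (Fin q) (Fin q) ℂ | P.trace = (m : ℂ)} :=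
      isClosed_eq (by fun_prop) continuous_const
    rw [hν, ae_map_iff hcont.measurable.aemeasurable hclosed.measurableSet]
    filter_upwards [hunit] with U hU
    rw [Matrix.mem_unitaryGroup_iff', star_eq_conjTranspose] at hU
    rw [hc, Matrix.trace_mul_comm, ← Matrix.mul_assoc, hU, Matrix.one_mul,
      Matrix.trace_eq_rank_of_mul_self hEproj, hErank]
  intro a b
  have key := hconj.integral_trace_mul_entry hq hproj htr hStr a b
  rw [hν, integral_map hcont.measurable.aemeasurable
    (Continuous.aestronglyMeasurable (by fun_prop))] at key
  have hm0 : (m : ℂ) ≠ 0 := by exact_mod_cast (by lia : m ≠ 0)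
  have hq0 : (q : ℂ) ≠ 0 := by exact_mod_cast (by lia : q ≠ 0)
  have hq1 : (q : ℂ) + 1 ≠ 0 := by exact_mod_cast (by lia : q + 1 ≠ 0)
  have hq2 : (q : ℂ) - 1 ≠ 0 := sub_ne_zero.2 (by exact_mod_cast (by lia : q ≠ 1))
  rw [inv_mul_eq_div, div_mul_div_comm, div_eq_div_iff hm0 (mul_ne_zero hq2 (mul_ne_zero hq0 hq1))]
  linear_combination key
end
end
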